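/- Suppose a⁰,a¹ : ℕ → ℂ² satisfy condition (A) and conditions (C1)–(C5), that 0 < ‖a⁰₀‖ < 1, that ⟨a⁰₁, a⁰₀⟩ = 0 and that ⟨a¹₀, a⁰₀⟩ ≠ 0. Set ρ := ‖a⁰₀‖. Then: a⁰_k = 0 for every k ≥ 2; ‖a⁰₁‖² = 1 − ρ²; and there exists λ₀ ∈ ℂ with |λ₀|² = (1 − ρ²)/ρ² such that a¹₀ = λ₀·a⁰₀, a¹₁ = −(ρ²/(1−ρ²))·λ₀·a⁰₁, and a¹_k = 0 for every k ≥ 2. (That is, the corresponding M⁺-inner matrix function is of Type 3.) -/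

import Mathlib

open Finset

/-- `ℂ²` with its Euclidean structure. -/
abbrev E2 := EuclideanSpace ℂ (Fin 2)

/-- The inner product of `ℂ²`: `⟨u,v⟩ = u⁽¹⁾conj(v⁽¹⁾) + u⁽²⁾conj(v⁽²⁾)`. -/
noncomputable def cinner (u v : E2) : ℂ := ∑ i, u i * (starRingEnd ℂ) (v i)

/-- Condition (A). -/
def condA (a0 a1 : ℕ → E2) : Prop :=
  (∀ m : ℕ, (∑' k : ℕ, cinner (a0 (k + m)) (a0 k)) = if m = 0 then 1 else 0) ∧
  (∀ m : ℕ, (∑' k : ℕ, cinner (a1 (k + m)) (a1 k)) = if m = 0 then 1 else 0) ∧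
  (∀ m : ℕ, (∑' k : ℕ, cinner (a0 (k + m)) (a1 k)) = 0) ∧
  (∀ m : ℕ, (∑' k : ℕ, cinner (a1 (k + m)) (a0 k)) = 0)

/-- Conditions (C1)–(C5), with `d := 1 − ‖a0 0‖²`. -/
def condC (a0 a1 : ℕ → E2) : Prop :=
  (∀ p : ℕ, 1 ≤ p → ‖cinner (a0 p) (a0 0)‖ ^ 2
      = (1 - ‖a0 0‖ ^ 2) * (1 - ∑ k ∈ Finset.range (p + 1), ‖a0 k‖ ^ 2)) ∧
  (∀ p : ℕ, ‖cinner (a1 p) (a0 0)‖ ^ 2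
      = (1 - ‖a0 0‖ ^ 2) * (1 - ∑ k ∈ Finset.range (p + 1), ‖a1 k‖ ^ 2)) ∧
  (∀ p p' : ℕ, 0 < p → p < p' →
    cinner (a0 p') (a0 0) * cinner (a0 0) (a0 p)
      = -((1 - ‖a0 0‖ ^ 2 : ℝ) : ℂ) *
          ∑ r ∈ Finset.range (p + 1), cinner (a0 (p' - r)) (a0 (p - r))) ∧
  (∀ p p' : ℕ, p < p' →
    cinner (a1 p') (a0 0) * cinner (a0 0) (a1 p)
      = -((1 - ‖a0 0‖ ^ 2 : ℝ) : ℂ) *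
          ∑ r ∈ Finset.range (p + 1), cinner (a1 (p' - r)) (a1 (p - r))) ∧
  (∀ p p' : ℕ, 0 < p → p ≤ p' →
    cinner (a1 p') (a0 0) * cinner (a0 0) (a0 p)
      = -((1 - ‖a0 0‖ ^ 2 : ℝ) : ℂ) *
          ∑ r ∈ Finset.range (p + 1), cinner (a1 (p' - r)) (a0 (p - r))) ∧
  (∀ p p' : ℕ, p' < p →
    cinner (a1 p') (a0 0) * cinner (a0 0) (a0 p)
      = -((1 - ‖a0 0‖ ^ 2 : ℝ) : ℂ) *
          ∑ r ∈ Finset.range (p' + 1), cinner (a1 (p' - r)) (a0 (p - r)))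

lemma cinner_eq_inner (u v : E2) : cinner u v = inner ℂ v u := by
  simp [cinner, PiLp.inner_apply]

lemma cinner_self (u : E2) : cinner u u = ((‖u‖ ^ 2 : ℝ) : ℂ) := by
  rw [cinner_eq_inner, inner_self_eq_norm_sq_to_K]
  norm_cast

lemma cinner_smul_left (c : ℂ) (u v : E2) : cinner (c • u) v = c * cinner u v := by
  simp only [cinner_eq_inner, inner_smul_right]

lemma cinner_conj (u v : E2) : (starRingEnd ℂ) (cinner u v) = cinner v u := by
  simp only [cinner_eq_inner, inner_conj_symm]

lemma cinner_eq_zero_symm {u v : E2} (h : cinner u v = 0) : cinner v u = 0 := by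
  rw [← cinner_conj, h, map_zero]

/-- In `ℂ²`, the orthogonal complement of a nonzero vector is a line. -/
lemma exists_eq_smul_of_cinner_eq_zero {u v w : E2} (hu : u ≠ 0) (hv : v ≠ 0)
    (huv : cinner u v = 0) (hwv : cinner w v = 0) : ∃ c : ℂ, w = c • u := by
  have : Fact (Module.finrank ℂ E2 = 1 + 1) := ⟨by simp⟩
  have hdim : Module.finrank ℂ (ℂ ∙ v)ᗮ = 1 := Submodule.finrank_orthogonal_span_singleton hv
  rw [cinner_eq_inner] at huv hwv
  obtain ⟨c, hc⟩ := exists_smul_eq_of_finrank_eq_one hdim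
    (x := ⟨u, Submodule.mem_orthogonal_singleton_iff_inner_right.mpr huv⟩)
    (by simpa [Subtype.ext_iff] using hu)
    ⟨w, Submodule.mem_orthogonal_singleton_iff_inner_right.mpr hwv⟩
  exact ⟨c, (congrArg Subtype.val hc).symm⟩

/-- If the partial sums of `‖f k‖ ^ 2` are at most `1` and already equal `1` after two terms,
then all later terms vanish. -/
lemma eq_zero_of_sum_norm_sq_le_one {f : ℕ → E2} (h : ‖f 0‖ ^ 2 + ‖f 1‖ ^ 2 = 1)
    (hle : ∀ p, 2 ≤ p → ∑ k ∈ Finset.range (p + 1), ‖f k‖ ^ 2 ≤ 1) (k : ℕ) (hk : 2 ≤ k) :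
    f k = 0 := by
  have hsub : Finset.range 2 ⊆ Finset.range k := Finset.range_mono hk
  have hmono := Finset.sum_le_sum_of_subset_of_nonneg hsub
    (f := fun k => ‖f k‖ ^ 2) (fun _ _ _ => sq_nonneg _)
  have hle' := hle k hk
  rw [Finset.sum_range_succ] at hle'
  simp only [Finset.sum_range_succ, Finset.sum_range_zero, zero_add] at hmono
  have : ‖f k‖ ^ 2 = 0 := le_antisymm (by linarith) (sq_nonneg _)
  simpa using this

theorem stmt14 (a0 a1 : ℕ → E2) (hA : condA a0 a1) (hC : condC a0 a1)
    (h00 : 0 < ‖a0 0‖) (h01 : ‖a0 0‖ < 1)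
    (hC2 : cinner (a0 1) (a0 0) = 0) (hC3 : cinner (a1 0) (a0 0) ≠ 0) :
    (∀ k : ℕ, 2 ≤ k → a0 k = 0) ∧
    ‖a0 1‖ ^ 2 = 1 - ‖a0 0‖ ^ 2 ∧
    (∃ lam : ℂ, ‖lam‖ ^ 2 = (1 - ‖a0 0‖ ^ 2) / ‖a0 0‖ ^ 2 ∧
      a1 0 = lam • a0 0 ∧
      a1 1 = (-((‖a0 0‖ ^ 2 / (1 - ‖a0 0‖ ^ 2) : ℝ) : ℂ) * lam) • a0 1 ∧
      (∀ k : ℕ, 2 ≤ k → a1 k = 0)) := by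
  obtain ⟨c1, c2, -, c4, c5, c5'⟩ := hC
  have hρ : 0 < ‖a0 0‖ ^ 2 := by positivity
  have hd : 0 < 1 - ‖a0 0‖ ^ 2 := by nlinarith
  have hdC : ((1 - ‖a0 0‖ ^ 2 : ℝ) : ℂ) ≠ 0 := Complex.ofReal_ne_zero.mpr hd.ne'
  have hn1 : ‖a0 1‖ ^ 2 = 1 - ‖a0 0‖ ^ 2 := by
    have h := c1 1 le_rfl
    simp only [hC2, Finset.sum_range_succ, Finset.sum_range_zero, norm_zero] at h
    have h' := (mul_eq_zero.mp (h.symm.trans (by norm_num))).resolve_left hd.ne'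
    linarith
  have hu : a0 0 ≠ 0 := norm_pos_iff.mp h00
  have hv : a0 1 ≠ 0 := by
    intro h
    rw [h, norm_zero] at hn1
    linarith
  have hz0 : ∀ k, 2 ≤ k → a0 k = 0 := by
    refine eq_zero_of_sum_norm_sq_le_one (by linarith) fun p hp => ?_
    have h := c1 p (by omega)
    have := nonneg_of_mul_nonneg_right (h ▸ sq_nonneg _) hd
    linarith
  have h01' : cinner (a0 0) (a0 1) = 0 := cinner_eq_zero_symm hC2
  have hb0 : cinner (a1 0) (a0 1) = 0 := by
    have h := c5' 1 0 one_pos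
    simp only [h01', mul_zero, zero_add, Finset.sum_range_one, Nat.sub_zero] at h
    exact (mul_eq_zero.mp h.symm).resolve_left (neg_ne_zero.mpr hdC)
  obtain ⟨lam, hlam⟩ := exists_eq_smul_of_cinner_eq_zero hu hv h01' hb0
  have hlam0 : lam ≠ 0 := by
    rintro rfl
    rw [hlam, cinner_smul_left, zero_mul] at hC3
    exact hC3 rfl
  have hnb0 : ‖a1 0‖ ^ 2 = ‖lam‖ ^ 2 * ‖a0 0‖ ^ 2 := by
    rw [hlam, norm_smul, mul_pow]
  have hlamsq : ‖lam‖ ^ 2 * ‖a0 0‖ ^ 2 = 1 - ‖a0 0‖ ^ 2 := by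
    have h := c2 0
    rw [zero_add, Finset.sum_range_one, hnb0, hlam, cinner_smul_left, cinner_self, norm_mul,
      Complex.norm_real, Real.norm_of_nonneg hρ.le] at h
    linear_combination h
  have hbp : ∀ p, 0 < p → cinner (a1 p) (a0 0) = 0 := by
    intro p hp
    have h := c4 0 p hp
    rw [zero_add, Finset.sum_range_one, Nat.sub_zero, Nat.sub_zero, ← cinner_conj (a1 0) (a0 0),
      ← cinner_conj (a1 0) (a1 p), hlam, cinner_smul_left, cinner_smul_left, map_mul, map_mul,
      cinner_conj, cinner_conj, cinner_self] at h
    have h' : (starRingEnd ℂ) lam * cinner (a1 p) (a0 0) = 0 := by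
      push_cast at h
      linear_combination h
    exact (mul_eq_zero.mp h').resolve_left ((map_ne_zero _).mpr hlam0)
  have hnb1 : ‖a1 0‖ ^ 2 + ‖a1 1‖ ^ 2 = 1 := by
    have h := c2 1
    simp only [hbp 1 one_pos, Finset.sum_range_succ, Finset.sum_range_zero, norm_zero] at h
    have h' := (mul_eq_zero.mp (h.symm.trans (by norm_num))).resolve_left hd.ne'
    linarith
  have hz1 : ∀ k, 2 ≤ k → a1 k = 0 := by
    refine eq_zero_of_sum_norm_sq_le_one hnb1 fun p hp => ?_
    have := nonneg_of_mul_nonneg_right (c2 p ▸ sq_nonneg _) hd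
    linarith
  obtain ⟨mu, hmu⟩ := exists_eq_smul_of_cinner_eq_zero hv hu hC2 (hbp 1 one_pos)
  refine ⟨hz0, hn1, lam, (eq_div_iff hρ.ne').mpr hlamsq, hlam, ?_, hz1⟩
  have h := c5 1 1 one_pos le_rfl
  rw [h01', mul_zero, Finset.sum_range_succ, Finset.sum_range_one, Nat.sub_zero, Nat.sub_self,
    hlam, hmu, cinner_smul_left, cinner_smul_left, cinner_self, cinner_self, hn1] at h
  have h' := (mul_eq_zero.mp h.symm).resolve_left (neg_ne_zero.mpr hdC)
  have hmul : mu = -((‖a0 0‖ ^ 2 / (1 - ‖a0 0‖ ^ 2) : ℝ) : ℂ) * lam := by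
    rw [Complex.ofReal_div]
    field_simp
    linear_combination h'
  rw [hmu, hmul]
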